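/- Let L be a finite bounded lattice that is noncomplemented, i.e., some element x with 0 < x < 1 has no complement. Then the order complex of L̄ = L \ {0,1} is nonevasive, hence collapsible and contractible. -/

import Mathlib

open scoped Classical

/-- An abstract simplicial complex as a finite family of nonempty finite faces,
closed under taking nonempty subsets, containing all its vertices as singletons. -/
def IsComplex {V : Type*} (K : Finset (Finset V)) : Prop :=
  (∀ σ ∈ K, σ.Nonempty) ∧ (∀ σ ∈ K, ∀ τ ⊆ σ, τ.Nonempty → τ ∈ K)

/-- The deletion of a vertex from a simplicial complex. -/
noncomputable def dlF {V : Type*} (K : Finset (Finset V)) (v : V) : Finset (Finset V) :=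
  K.filter fun σ => v ∉ σ

/-- The link of a vertex in a simplicial complex. -/
noncomputable def lkF {V : Type*} (K : Finset (Finset V)) (v : V) : Finset (Finset V) :=
  K.filter fun σ => v ∉ σ ∧ insert v σ ∈ K

/-- Nonevasiveness: a point is nonevasive, and `K` is nonevasive if some vertex has
nonevasive link and deletion. -/
inductive Nonevasive {V : Type*} : Finset (Finset V) → Prop
  | point (v : V) : Nonevasive {{v}}
  | step (K : Finset (Finset V)) (v : V) (hv : {v} ∈ K)
      (hlk : Nonevasive (lkF K v)) (hdl : Nonevasive (dlF K v)) : Nonevasive K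

/-- Collapsibility: `K` can be reduced to a point by elementary collapses, where an
elementary collapse removes a pair `(σ, τ)` with `σ` a proper face of exactly one face `τ`. -/
inductive Collapsible {V : Type*} : Finset (Finset V) → Prop
  | point (v : V) : Collapsible {{v}}
  | collapse (K : Finset (Finset V)) (σ τ : Finset V) (hσ : σ ∈ K) (hτ : τ ∈ K)
      (hst : σ ⊂ τ) (huniq : ∀ ρ ∈ K, σ ⊂ ρ → ρ = τ)
      (h : Collapsible (K \ {σ, τ})) : Collapsible K

/-- The order complex of the subposet `S` of `P`: faces are the nonempty chains in `S`. -/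
noncomputable def orderComplexOn (P : Type*) [Fintype P] [PartialOrder P] (S : Set P) :
    Finset (Finset P) :=
  Finset.univ.filter fun σ => σ.Nonempty ∧ ↑σ ⊆ S ∧ IsChain (· ≤ ·) (σ : Set P)

theorem ne_step {L : Type*} [Fintype L] [PartialOrder L] (S : Set L) (v : L) (hv : v ∈ S)
    (hl : Nonevasive (orderComplexOn L {w | w ∈ S ∧ (w < v ∨ v < w)}))
    (hd : Nonevasive (orderComplexOn L (S \ {v}))) : Nonevasive (orderComplexOn L S) := by
  refine Nonevasive.step _ v ?_ ?_ ?_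
  · simp [orderComplexOn, hv]
  · convert hl using 1
    ext σ
    simp only [lkF, orderComplexOn, Finset.mem_filter, Finset.mem_univ, true_and]
    constructor
    · rintro ⟨⟨h1, h2, h3⟩, h4, -, h5, h6⟩
      refine ⟨h1, ?_, h3⟩
      intro w hw
      have hwv : w ≠ v := by
        rintro rfl
        exact h4 (by simpa using hw)
      refine ⟨h2 hw, ?_⟩
      have := h6 (by simpa using Or.inr hw : w ∈ ((insert v σ : Finset L) : Set L))
        (by simp : v ∈ ((insert v σ : Finset L) : Set L)) hwv
      rcases this with h | h
      · exact Or.inl (lt_of_le_of_ne h hwv)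
      · exact Or.inr (lt_of_le_of_ne h hwv.symm)
    · rintro ⟨h1, h2, h3⟩
      refine ⟨⟨h1, fun w hw => (h2 hw).1, h3⟩, ?_, by simp, ?_, ?_⟩
      · intro h
        have := (h2 (by simpa using h : v ∈ (σ : Set L))).2
        simp at this
      · intro w hw
        rw [Finset.coe_insert] at hw
        rcases hw with rfl | hw
        · exact hv
        · exact (h2 hw).1
      · rw [Finset.coe_insert]
        refine h3.insert ?_
        intro b hb _
        rcases (h2 hb).2 with h | h
        · exact Or.inr h.le
        · exact Or.inl h.le
  · convert hd using 1
    ext σ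
    simp only [dlF, orderComplexOn, Finset.mem_filter, Finset.mem_univ, true_and]
    constructor
    · rintro ⟨⟨h1, h2, h3⟩, h4⟩
      refine ⟨h1, fun w hw => ⟨h2 hw, ?_⟩, h3⟩
      rintro rfl
      exact h4 (by simpa using hw)
    · rintro ⟨h1, h2, h3⟩
      refine ⟨⟨h1, fun w hw => (h2 hw).1, h3⟩, fun h => ?_⟩
      exact (h2 (by simpa using h : v ∈ (σ : Set L))).2 rfl

theorem ne_cone {L : Type*} [Fintype L] [PartialOrder L] (a : L) (S : Set L) (ha : a ∈ S)
    (h : ∀ w ∈ S, w ≤ a ∨ a ≤ w) : Nonevasive (orderComplexOn L S) := by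
  induction S using WellFoundedLT.induction with
  | ind S ih =>
  by_cases hS : ∃ v ∈ S, v ≠ a
  · obtain ⟨v, hv, hva⟩ := hS
    apply ne_step S v hv
    · apply ih
      · refine (Set.ssubset_iff_of_subset (fun w hw => hw.1)).2 ⟨v, hv, ?_⟩
        simp
      · refine ⟨ha, ?_⟩
        rcases h v hv with h | h
        · exact Or.inr (lt_of_le_of_ne h hva)
        · exact Or.inl (lt_of_le_of_ne h hva.symm)
      · exact fun w hw => h w hw.1
    · apply ih
      · refine (Set.ssubset_iff_of_subset (fun w hw => hw.1)).2 ⟨v, hv, ?_⟩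
        simp
      · exact ⟨ha, fun h => hva h.symm⟩
      · exact fun w hw => h w hw.1
  · push Not at hS
    convert Nonevasive.point a
    ext σ
    simp only [orderComplexOn, Finset.mem_filter, Finset.mem_univ, true_and, Finset.mem_singleton]
    constructor
    · rintro ⟨h1, h2, -⟩
      exact Finset.eq_singleton_iff_nonempty_unique_mem.2
        ⟨h1, fun w hw => hS w (h2 (by simpa using hw))⟩
    · rintro rfl
      simp [ha]

theorem ne_cone2 {L : Type*} [Fintype L] [Lattice L] (y : L) (S : Set L) (hy : y ∈ S)
    (h : ∀ w ∈ S, w ⊔ y ∈ S) : Nonevasive (orderComplexOn L S) := by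
  induction S using WellFoundedLT.induction with
  | ind S ih =>
  by_cases hS : ∃ v ∈ S, ¬ y ≤ v
  · obtain ⟨z, hz⟩ := (Set.toFinite {v | v ∈ S ∧ ¬ y ≤ v}).exists_maximal hS
    obtain ⟨⟨hzS, hzy⟩, hmax⟩ := hz
    apply ne_step S z hzS
    · apply ne_cone (z ⊔ y)
      · refine ⟨h z hzS, Or.inr (lt_of_le_of_ne le_sup_left ?_)⟩
        intro e
        exact hzy (e ▸ le_sup_right)
      · rintro w ⟨hw, hwz | hwz⟩
        · exact Or.inl (hwz.le.trans le_sup_left)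
        · right
          refine sup_le hwz.le ?_
          by_contra hc
          exact absurd (hmax ⟨hw, hc⟩ hwz.le) (not_le_of_gt hwz)
    · apply ih
      · refine (Set.ssubset_iff_of_subset (fun w hw => hw.1)).2 ⟨z, hzS, ?_⟩
        simp
      · exact ⟨hy, fun e => hzy (le_of_eq e)⟩
      · rintro w ⟨hw, -⟩
        exact ⟨h w hw, fun e => hzy (le_sup_right.trans (le_of_eq e))⟩
  · push Not at hS
    exact ne_cone y S hy fun w hw => Or.inr (hS w hw)

theorem ne_peel {L : Type*} [Fintype L] [Lattice L] [BoundedOrder L] (a y : L) (hy : ⊥ < y)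
    (hya : y < a)
    (hA : ∀ z, ⊥ < z → z < a → z ⊔ y = a → Nonevasive (orderComplexOn L (Set.Ioo ⊥ z)))
    (T : Set L) (hT : T ⊆ Set.Ioo ⊥ a) (hlow : ∀ z ∈ T, ∀ w, ⊥ < w → w ≤ z → w ∈ T)
    (hB : ∀ z ∈ Set.Ioo ⊥ a, z ⊔ y ≠ a → z ∈ T) : Nonevasive (orderComplexOn L T) := by
  induction T using WellFoundedLT.induction with
  | ind T ih =>
  by_cases hS : ∃ v ∈ T, v ⊔ y = a
  · obtain ⟨z, hz⟩ := (Set.toFinite {v | v ∈ T ∧ v ⊔ y = a}).exists_maximal hS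
    obtain ⟨⟨hzT, hzy⟩, hmax⟩ := hz
    have hup : ∀ w ∈ T, ¬ z < w := by
      intro w hw hzw
      refine absurd (hmax ⟨hw, ?_⟩ hzw.le) (not_le_of_gt hzw)
      apply le_antisymm (sup_le (hT hw).2.le hya.le)
      rw [← hzy]
      exact sup_le_sup_right hzw.le y
    apply ne_step T z hzT
    · convert hA z (hT hzT).1 (hT hzT).2 hzy using 2
      ext w
      constructor
      · rintro ⟨hw, h | h⟩
        · exact ⟨(hT hw).1, h⟩
        · exact absurd h (hup w hw)
      · rintro ⟨h1, h2⟩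
        exact ⟨hlow z hzT w h1 h2.le, Or.inl h2⟩
    · apply ih
      · refine (Set.ssubset_iff_of_subset (fun w hw => hw.1)).2 ⟨z, hzT, ?_⟩
        simp
      · exact fun w hw => hT hw.1
      · rintro u ⟨hu, huz⟩ w hw hwu
        refine ⟨hlow u hu w hw hwu, ?_⟩
        rintro rfl
        exact hup u hu (lt_of_le_of_ne hwu fun e => huz e.symm)
      · intro w hw hwy
        refine ⟨hB w hw hwy, ?_⟩
        rintro rfl
        exact hwy hzy
  · push Not at hS
    apply ne_cone2 y
    · exact hB y ⟨hy, hya⟩ (by simpa using hya.ne)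
    · intro w hw
      apply hB
      · exact ⟨hy.trans_le le_sup_right,
          lt_of_le_of_ne (sup_le (hT hw).2.le hya.le) (hS w hw)⟩
      · simpa using hS w hw

theorem ne_Ioo {L : Type*} [Fintype L] [Lattice L] [BoundedOrder L] (a : L) :
    ∀ y : L, ⊥ < y → y < a → (¬ ∃ z, y ⊓ z = ⊥ ∧ y ⊔ z = a) →
      Nonevasive (orderComplexOn L (Set.Ioo ⊥ a)) := by
  induction a using WellFoundedLT.induction with
  | ind a ih =>
  intro y hy hya hnc
  apply ne_peel a y hy hya
  · intro z hz hza hzy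
    apply ih z hza (y ⊓ z)
    · refine bot_lt_iff_ne_bot.2 fun h => hnc ⟨z, h, ?_⟩
      rw [sup_comm, hzy]
    · refine lt_of_le_of_ne inf_le_right fun h => ?_
      have : z ≤ y := inf_eq_right.1 h
      rw [sup_eq_right.2 this] at hzy
      exact hya.ne hzy
    · rintro ⟨w, h1, h2⟩
      have hwz : w ≤ z := by
        rw [← h2]
        exact le_sup_right
      refine hnc ⟨w, ?_, ?_⟩
      · rw [← h1, inf_assoc, inf_eq_right.2 hwz]
      · apply le_antisymm (sup_le hya.le (hwz.trans hza.le))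
        rw [← hzy]
        refine sup_le ?_ le_sup_left
        rw [← h2]
        exact sup_le (inf_le_left.trans le_sup_left) le_sup_right
  · exact subset_rfl
  · exact fun z hz w hw hwz => ⟨hw, hwz.trans_lt hz.2⟩
  · exact fun z hz _ => hz

theorem coll_cone {V : Type*} (v : V) (M : Finset (Finset V)) (hM : Collapsible M) :
    ∀ D : Finset (Finset V), Collapsible D → (∀ σ ∈ D, v ∉ σ) → (∀ σ ∈ M, v ∉ σ ∧ σ.Nonempty) →
      Collapsible (D ∪ {{v}} ∪ M.image (insert v)) := by
  induction hM with
  | point w =>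
    intro D hD hDv hMv
    have hvw : v ≠ w := by simpa using (hMv {w} (by simp)).1
    refine Collapsible.collapse _ {v} {v, w} (by simp) (by simp) ?_ ?_ ?_
    · refine (Finset.ssubset_iff_of_subset (by simp)).2 ⟨w, by simp, by simpa using hvw.symm⟩
    · intro ρ hρ hs
      simp only [Finset.mem_union, Finset.mem_singleton, Finset.image_singleton] at hρ
      rcases hρ with (h | h) | h
      · exact absurd (hs.1 (by simp)) (hDv ρ h)
      · subst h
        exact absurd hs (by simp)
      · exact h
    · convert hD using 1
      ext ρ
      simp only [Finset.mem_sdiff, Finset.mem_union, Finset.mem_singleton, Finset.image_singleton,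
        Finset.mem_insert]
      constructor
      · tauto
      · intro h
        refine ⟨Or.inl (Or.inl h), ?_⟩
        rintro (rfl | rfl)
        · exact hDv _ h (by simp)
        · exact hDv _ h (by simp)
  | collapse K σ τ hσ hτ hst huniq h ih =>
    intro D hD hDv hMv
    have hins : ∀ α β : Finset V, v ∉ α → insert v α ⊆ insert v β → α ⊆ β := by
      intro α β hα hs u hu
      rcases Finset.mem_insert.1 (hs (Finset.mem_insert_of_mem hu)) with rfl | h
      · exact absurd hu hα
      · exact h
    have hinj : ∀ α ∈ K, ∀ β ∈ K, insert v α = insert v β → α = β := fun α hα β hβ e =>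
      (hins α β (hMv α hα).1 e.le).antisymm (hins β α (hMv β hβ).1 e.ge)
    have hne : ∀ α ∈ K, insert v α ≠ {v} := by
      intro α hα e
      obtain ⟨u, hu⟩ := (hMv α hα).2
      have : u ∈ insert v α := Finset.mem_insert_of_mem hu
      rw [e, Finset.mem_singleton] at this
      subst this
      exact (hMv α hα).1 hu
    refine Collapsible.collapse _ (insert v σ) (insert v τ) ?_ ?_ ?_ ?_ ?_
    · exact Finset.mem_union_right _ (Finset.mem_image_of_mem _ hσ)
    · exact Finset.mem_union_right _ (Finset.mem_image_of_mem _ hτ)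
    · exact ⟨Finset.insert_subset_insert _ hst.1, fun h => hst.2 (hins _ _ (hMv τ hτ).1 h)⟩
    · intro ρ hρ hs
      simp only [Finset.mem_union, Finset.mem_singleton, Finset.mem_image] at hρ
      rcases hρ with (h | h) | ⟨m, hm, rfl⟩
      · exact absurd (hs.1 (by simp)) (hDv ρ h)
      · subst h
        exact absurd (by simp) hs.2
      · rw [huniq m hm ⟨hins _ _ (hMv σ hσ).1 hs.1,
          fun h => hs.2 (Finset.insert_subset_insert _ h)⟩]
    · convert ih D hD hDv (fun α hα => hMv α (Finset.mem_sdiff.1 hα).1) using 1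
      ext ρ
      simp only [Finset.mem_sdiff, Finset.mem_union, Finset.mem_singleton, Finset.mem_image,
        Finset.mem_insert, not_or]
      constructor
      · rintro ⟨(h | h) | ⟨m, hm, rfl⟩, h1, h2⟩
        · exact Or.inl (Or.inl h)
        · exact Or.inl (Or.inr h)
        · refine Or.inr ⟨m, ⟨hm, ?_, ?_⟩, rfl⟩
          · rintro rfl
            exact h1 rfl
          · rintro rfl
            exact h2 rfl
      · rintro ((h | h) | ⟨m, ⟨hm, h1, h2⟩, rfl⟩)
        · refine ⟨Or.inl (Or.inl h), ?_, ?_⟩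
          · rintro rfl
            exact hDv _ h (by simp)
          · rintro rfl
            exact hDv _ h (by simp)
        · subst h
          exact ⟨Or.inl (Or.inr rfl), (hne σ hσ).symm, (hne τ hτ).symm⟩
        · exact ⟨Or.inr ⟨m, hm, rfl⟩, fun e => h1 (hinj _ hm _ hσ e),
            fun e => h2 (hinj _ hm _ hτ e)⟩

theorem ne_coll {V : Type*} (K : Finset (Finset V)) (hK : Nonevasive K) :
    IsComplex K → Collapsible K := by
  induction hK with
  | point v => exact fun _ => Collapsible.point v
  | step K v hv hlk hdl ih1 ih2 =>
    rintro ⟨h1, h2⟩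
    have c1 : IsComplex (lkF K v) := by
      refine ⟨fun σ hσ => h1 σ (Finset.mem_filter.1 hσ).1, fun σ hσ τ hτ hn => ?_⟩
      obtain ⟨a, b, c⟩ := Finset.mem_filter.1 hσ
      exact Finset.mem_filter.2 ⟨h2 σ a τ hτ hn, fun h => b (hτ h),
        h2 _ c _ (Finset.insert_subset_insert _ hτ) (by simp)⟩
    have c2 : IsComplex (dlF K v) := by
      refine ⟨fun σ hσ => h1 σ (Finset.mem_filter.1 hσ).1, fun σ hσ τ hτ hn => ?_⟩
      obtain ⟨a, b⟩ := Finset.mem_filter.1 hσ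
      exact Finset.mem_filter.2 ⟨h2 σ a τ hτ hn, fun h => b (hτ h)⟩
    convert coll_cone v _ (ih1 c1) _ (ih2 c2) (fun σ hσ => (Finset.mem_filter.1 hσ).2)
      (fun σ hσ => ⟨(Finset.mem_filter.1 hσ).2.1, c1.1 σ hσ⟩) using 1
    ext ρ
    simp only [Finset.mem_union, Finset.mem_singleton, Finset.mem_image, lkF, dlF,
      Finset.mem_filter]
    constructor
    · intro h
      by_cases hvρ : v ∈ ρ
      · by_cases e : ρ = {v}
        · exact Or.inl (Or.inr e)
        · refine Or.inr ⟨ρ.erase v, ⟨h2 ρ h _ (Finset.erase_subset _ _) ?_, by simp, ?_⟩,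
            Finset.insert_erase hvρ⟩
          · rw [Finset.nonempty_iff_ne_empty]
            intro h0
            apply e
            rw [← Finset.insert_erase hvρ, h0]
            rfl
          · rwa [Finset.insert_erase hvρ]
      · exact Or.inl (Or.inl ⟨h, hvρ⟩)
    · rintro ((h | h) | ⟨m, hm, rfl⟩)
      · exact h.1
      · rwa [h]
      · exact hm.2.2

/-- The order complex of a finite noncomplemented lattice (minus ⊥ and ⊤) is
nonevasive, hence collapsible. -/
theorem stmt_12 {L : Type*} [Lattice L] [Fintype L] [BoundedOrder L]
    (x : L) (hx : ⊥ < x) (hx' : x < ⊤)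
    (hnc : ¬ ∃ z : L, x ⊓ z = ⊥ ∧ x ⊔ z = ⊤) :
    Nonevasive (orderComplexOn L {p | p ≠ ⊥ ∧ p ≠ ⊤}) ∧
    Collapsible (orderComplexOn L {p | p ≠ ⊥ ∧ p ≠ ⊤}) := by
  have key : Nonevasive (orderComplexOn L {p | p ≠ ⊥ ∧ p ≠ ⊤}) := by
    convert ne_Ioo (⊤ : L) x hx hx' hnc using 2
    ext p
    simp [bot_lt_iff_ne_bot, lt_top_iff_ne_top]
  refine ⟨key, ne_coll _ key ⟨?_, ?_⟩⟩
  · intro σ hσ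
    exact (Finset.mem_filter.1 hσ).2.1
  · intro σ hσ τ hτ hn
    obtain ⟨_, _, h2, h3⟩ := Finset.mem_filter.1 hσ
    have hs : (τ : Set L) ⊆ σ := by exact_mod_cast hτ
    exact Finset.mem_filter.2 ⟨Finset.mem_univ _, hn, hs.trans h2, h3.mono hs⟩
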